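/- arXiv:2103.15631 — 4 statements merged into one kernel-verified Lean document; each statement's English description precedes it below -/
import Mathlib

section
/- Suppose the data satisfy X1 = A·X0 + B·U0 + L·F0 and the matrix W0 obtained by stacking U0 on top of X0 has full row rank m+n. Then: (a) for every K ∈ ℝ^{m×n} there exists G ∈ ℝ^{T×n} with U0·G = K and X0·G = I_n; and (b) for any G ∈ ℝ^{T×n} satisfying U0·G = K and X0·G = I_n, one has A + B·K = (X1 − L·F0)·G. -/
open Matrix

/-- A matrix over a field whose rank equals its number of rows has a right inverse. -/
theorem Matrix.exists_right_inverse_of_rank_eq_card {ι κ 𝕜 : Type*} [Fintype ι] [DecidableEq ι]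
    [Fintype κ] [Field 𝕜] (M : Matrix ι κ 𝕜) (h : M.rank = Fintype.card ι) :
    ∃ N : Matrix κ ι 𝕜, M * N = 1 := by
  classical
  rw [← Matrix.mulVec_surjective_iff_exists_right_inverse]
  have hrange : LinearMap.range M.mulVecLin = ⊤ := by
    apply Submodule.eq_top_of_finrank_eq
    rw [Module.finrank_fintype_fun_eq_card]
    exact h
  exact LinearMap.range_eq_top.mp hrange

/-- Data-based representation: if `X1 = A X0 + B U0 + L F0` and the stacked matrix
`W0 = [U0; X0]` has full row rank `m + n`, then (a) every gain `K` can be written via some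
`G` with `U0 G = K`, `X0 G = I`, and (b) for such `G`, `A + B K = (X1 - L F0) G`. -/
theorem data_based_representation
    (n m q T : ℕ) (hn : 0 < n) (hm : 0 < m) (hq : 0 < q) (hT : 0 < T)
    (A : Matrix (Fin n) (Fin n) ℝ) (B : Matrix (Fin n) (Fin m) ℝ)
    (L : Matrix (Fin n) (Fin q) ℝ)
    (U0 : Matrix (Fin m) (Fin T) ℝ) (X0 X1 : Matrix (Fin n) (Fin T) ℝ)
    (F0 : Matrix (Fin q) (Fin T) ℝ)
    (hdata : X1 = A * X0 + B * U0 + L * F0)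
    (hrank : (Matrix.fromRows U0 X0).rank = m + n) :
    (∀ K : Matrix (Fin m) (Fin n) ℝ, ∃ G : Matrix (Fin T) (Fin n) ℝ,
        U0 * G = K ∧ X0 * G = 1) ∧
    (∀ (K : Matrix (Fin m) (Fin n) ℝ) (G : Matrix (Fin T) (Fin n) ℝ),
        U0 * G = K → X0 * G = 1 → A + B * K = (X1 - L * F0) * G) := by
  refine ⟨fun K => ?_, fun K G hU hX => ?_⟩
  · obtain ⟨N, hN⟩ := Matrix.exists_right_inverse_of_rank_eq_card (Matrix.fromRows U0 X0)
      (by simpa using hrank)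
    let R : Matrix (Fin m ⊕ Fin n) (Fin n) ℝ := Matrix.fromRows K 1
    have hG : Matrix.fromRows U0 X0 * (N * R) = R := by
      rw [← Matrix.mul_assoc, hN, Matrix.one_mul]
    rw [Matrix.fromRows_mul] at hG
    exact ⟨N * R, Matrix.fromRows_inj hG⟩
  · rw [hdata, add_sub_cancel_right, Matrix.add_mul, Matrix.mul_assoc, Matrix.mul_assoc, hU, hX,
      Matrix.mul_one]
end

section
/- Let G ∈ ℝ^{T×n} and let P ∈ ℝ^{n×n} be symmetric positive definite. Assume Q is positive semidefinite and the block matrix [[Gᵀ Mᵀ P M G − P + Q, Gᵀ Mᵀ P L + S], [Lᵀ P M G + Sᵀ, Lᵀ P L + R]] is negative definite. Then, writing A_cl := M·G, for every ω ∈ ℝ the complex matrix e^{iω} I_n − A_cl is invertible and, with W(ω) := (e^{iω} I_n − A_cl)⁻¹·L ∈ ℂ^{n×q}, the Hermitian matrix W(ω)* Q W(ω) + W(ω)* S + Sᵀ W(ω) + R is negative definite (where * denotes conjugate transpose). -/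
open Matrix
open scoped ComplexOrder

/-- The complexification of a real positive semidefinite matrix is positive semidefinite. -/
theorem Matrix.PosSemidef.map_algebraMap_complex {m : Type*} [Fintype m] [DecidableEq m]
    {A : Matrix m m ℝ} (hA : A.PosSemidef) : (A.map (algebraMap ℝ ℂ)).PosSemidef := by
  open scoped MatrixOrder Matrix.Norms.L2Operator in
  obtain ⟨B, rfl⟩ := CStarAlgebra.nonneg_iff_eq_star_mul_self.mp hA.nonneg
  have h : (star B * B).map (algebraMap ℝ ℂ)
      = (B.map (algebraMap ℝ ℂ))ᴴ * B.map (algebraMap ℝ ℂ) := by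
    rw [Matrix.map_mul, Matrix.star_eq_conjTranspose]
    congr 1
    ext i j
    simp
  exact h ▸ Matrix.posSemidef_conjTranspose_mul_self _

/-- The complexification of a real positive definite matrix is positive definite. -/
theorem Matrix.PosDef.map_algebraMap_complex {m : Type*} [Fintype m] [DecidableEq m]
    {A : Matrix m m ℝ} (hA : A.PosDef) : (A.map (algebraMap ℝ ℂ)).PosDef :=
  hA.posSemidef.map_algebraMap_complex.posDef_iff_isUnit.2
    (hA.isUnit.map (algebraMap ℝ ℂ).mapMatrix)

/-- If the Stein inequality `Aᴴ P A - P + Q ≺ 0` holds with `Q ⪰ 0`, then `A` has no eigenvalue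
on the unit circle. -/
theorem isUnit_smul_one_sub_of_posDef_neg_stein {m : Type*} [Fintype m] [DecidableEq m]
    {A P Q : Matrix m m ℂ} {z : ℂ} (hz : star z * z = 1) (hQ : Q.PosSemidef)
    (h : (-(Aᴴ * P * A - P + Q)).PosDef) :
    IsUnit (z • (1 : Matrix m m ℂ) - A) := by
  rw [Matrix.isUnit_iff_isUnit_det, isUnit_iff_ne_zero]
  intro hdet
  obtain ⟨v, hv, hvA⟩ := Matrix.exists_mulVec_eq_zero_iff.2 hdet
  have hAv : A *ᵥ v = z • v := by
    rw [Matrix.sub_mulVec, Matrix.smul_mulVec, Matrix.one_mulVec, sub_eq_zero] at hvA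
    exact hvA.symm
  have hpos := h.dotProduct_mulVec_pos hv
  have hstein : star v ⬝ᵥ ((Aᴴ * P * A) *ᵥ v) = star v ⬝ᵥ (P *ᵥ v) := by
    rw [Matrix.mul_assoc, ← Matrix.mulVec_mulVec, Matrix.dotProduct_mulVec,
      ← Matrix.star_mulVec, ← Matrix.mulVec_mulVec, hAv, Matrix.mulVec_smul, star_smul,
      smul_dotProduct, dotProduct_smul, smul_smul, hz, one_smul]
  rw [Matrix.neg_mulVec, Matrix.add_mulVec, Matrix.sub_mulVec, dotProduct_neg, dotProduct_add,
    dotProduct_sub, hstein, sub_self, zero_add] at hpos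
  exact absurd (hQ.dotProduct_mulVec_nonneg v) (neg_pos.1 hpos).not_ge

/-- A frequency-domain inequality obtained by evaluating the block matrix inequality on the
range of `[W; 1]`, where `A W + L = z W` and `|z| = 1`. -/
theorem posDef_frequency_domain_of_fromBlocks {m p : Type*} [Fintype m] [Fintype p]
    [DecidableEq p] {A P Q : Matrix m m ℂ} {L S W : Matrix m p ℂ} {R : Matrix p p ℂ}
    {z : ℂ} (hz : star z * z = 1) (hW : A * W + L = z • W)
    (h : (-(Matrix.fromBlocks (Aᴴ * P * A - P + Q) (Aᴴ * P * L + S)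
      (Lᴴ * P * A + Sᴴ) (Lᴴ * P * L + R))).PosDef) :
    (-(Wᴴ * Q * W + Wᴴ * S + Sᴴ * W + R)).PosDef := by
  have hinj : Function.Injective (Matrix.fromRows W (1 : Matrix p p ℂ)).mulVec := by
    intro x y hxy
    simpa using congrArg (· ∘ Sum.inr) hxy
  have hquad : (A * W + L)ᴴ * P * (A * W + L) = Wᴴ * P * W := by
    rw [hW, Matrix.conjTranspose_smul, Matrix.smul_mul, Matrix.smul_mul, Matrix.mul_smul,
      smul_smul, hz, one_smul]
  convert h.conjTranspose_mul_mul_same hinj using 1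
  rw [Matrix.conjTranspose_fromRows_eq_fromCols_conjTranspose, Matrix.mul_neg, Matrix.neg_mul,
    Matrix.fromCols_mul_fromBlocks, Matrix.fromCols_mul_fromRows, neg_inj]
  simp only [Matrix.conjTranspose_add, Matrix.conjTranspose_mul, Matrix.add_mul, Matrix.mul_add,
    Matrix.sub_mul, Matrix.mul_sub, Matrix.conjTranspose_one, Matrix.one_mul, Matrix.mul_one,
    Matrix.mul_assoc] at hquad ⊢
  rw [eq_comm, ← sub_eq_zero, ← sub_eq_zero.2 hquad]
  abel

/-- Frequency-domain condition: if the normalized matrix inequality holds with `Q ⪰ 0`, then for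
every `ω` the matrix `e^{iω} I − A_cl` (with `A_cl = M·G`) is invertible and, with
`W(ω) = (e^{iω} I − A_cl)⁻¹ L`, the Hermitian matrix `W* Q W + W* S + Sᵀ W + R` is
negative definite. -/
theorem closed_loop_frequency_domain_condition
    (n q T : ℕ) (hn : 0 < n) (hq : 0 < q) (hT : 0 < T)
    (L : Matrix (Fin n) (Fin q) ℝ) (M : Matrix (Fin n) (Fin T) ℝ)
    (Q : Matrix (Fin n) (Fin n) ℝ) (hQpsd : Q.PosSemidef)
    (S : Matrix (Fin n) (Fin q) ℝ)
    (R : Matrix (Fin q) (Fin q) ℝ) (hR : (-R).PosDef)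
    (G : Matrix (Fin T) (Fin n) ℝ)
    (P : Matrix (Fin n) (Fin n) ℝ) (hP : P.PosDef)
    (hMI : (-(Matrix.fromBlocks
        (Gᵀ * Mᵀ * P * M * G - P + Q) (Gᵀ * Mᵀ * P * L + S)
        (Lᵀ * P * M * G + Sᵀ) (Lᵀ * P * L + R))).PosDef) :
    ∀ ω : ℝ,
      IsUnit (Complex.exp (ω * Complex.I) • (1 : Matrix (Fin n) (Fin n) ℂ)
          - (M * G).map (algebraMap ℝ ℂ)) ∧
      (-(((Complex.exp (ω * Complex.I) • (1 : Matrix (Fin n) (Fin n) ℂ)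
              - (M * G).map (algebraMap ℝ ℂ))⁻¹ * L.map (algebraMap ℝ ℂ))ᴴ
            * Q.map (algebraMap ℝ ℂ)
            * ((Complex.exp (ω * Complex.I) • (1 : Matrix (Fin n) (Fin n) ℂ)
              - (M * G).map (algebraMap ℝ ℂ))⁻¹ * L.map (algebraMap ℝ ℂ))
          + ((Complex.exp (ω * Complex.I) • (1 : Matrix (Fin n) (Fin n) ℂ)
              - (M * G).map (algebraMap ℝ ℂ))⁻¹ * L.map (algebraMap ℝ ℂ))ᴴ
            * S.map (algebraMap ℝ ℂ)
          + (S.map (algebraMap ℝ ℂ))ᵀ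
            * ((Complex.exp (ω * Complex.I) • (1 : Matrix (Fin n) (Fin n) ℂ)
              - (M * G).map (algebraMap ℝ ℂ))⁻¹ * L.map (algebraMap ℝ ℂ))
          + R.map (algebraMap ℝ ℂ))).PosDef := by
  intro ω
  have hz : star (Complex.exp (ω * Complex.I)) * Complex.exp (ω * Complex.I) = 1 := by
    rw [Complex.star_def, ← Complex.exp_conj, ← Complex.exp_add]
    simp
  have hmap : ∀ {a b : ℕ} (B : Matrix (Fin a) (Fin b) ℝ),
      Bᵀ.map (algebraMap ℝ ℂ) = (B.map (algebraMap ℝ ℂ))ᴴ := by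
    intro a b B
    ext i j
    simp
  have hadd : ∀ {a b : ℕ} (B C : Matrix (Fin a) (Fin b) ℝ),
      (B + C).map (algebraMap ℝ ℂ) = B.map (algebraMap ℝ ℂ) + C.map (algebraMap ℝ ℂ) :=
    fun B C => Matrix.map_add _ (map_add _) B C
  have hsub : ∀ {a b : ℕ} (B C : Matrix (Fin a) (Fin b) ℝ),
      (B - C).map (algebraMap ℝ ℂ) = B.map (algebraMap ℝ ℂ) - C.map (algebraMap ℝ ℂ) :=
    fun B C => Matrix.map_sub _ (map_sub _) B C
  have hblock := hMI.map_algebraMap_complex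
  rw [Matrix.map_neg _ (map_neg _), Matrix.fromBlocks_map] at hblock
  have hGM : Gᵀ * Mᵀ = (M * G)ᵀ := (Matrix.transpose_mul M G).symm
  rw [hGM, Matrix.mul_assoc _ M G, Matrix.mul_assoc _ M G] at hblock
  generalize M * G = A at hblock ⊢
  simp only [hadd, hsub, Matrix.map_mul, hmap] at hblock
  have hQ : (Q.map (algebraMap ℝ ℂ)).PosSemidef := hQpsd.map_algebraMap_complex
  have hcorner := hblock.submatrix Sum.inl_injective
  rw [Matrix.submatrix_neg] at hcorner
  have hunit := isUnit_smul_one_sub_of_posDef_neg_stein hz hQ hcorner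
  refine ⟨hunit, ?_⟩
  rw [← Matrix.transpose_map, hmap]
  refine posDef_frequency_domain_of_fromBlocks hz ?_ hblock
  have hinv := Matrix.mul_nonsing_inv_cancel_left _ (L.map (algebraMap ℝ ℂ))
    ((Matrix.isUnit_iff_isUnit_det _).1 hunit)
  rw [Matrix.sub_mul, Matrix.smul_mul, Matrix.one_mul] at hinv
  exact (sub_eq_iff_eq_add'.1 hinv).symm
end

section
/- Suppose there exists Y ∈ ℝ^{T×n} such that: X0·Y is symmetric positive definite; Yᵀ·Mᵀ + M·Y is negative definite; and L + X0·Y·Hᵀ = 0. Then, setting P := (X0·Y)⁻¹ and K := U0·Y·(X0·Y)⁻¹, one has: P is symmetric positive definite, (A+B·K)ᵀ·P + P·(A+B·K) is negative definite, P·L = −Hᵀ, and consequently for every x ∈ ℝ^n with x ≠ 0 and every v ∈ ℝ^p with (H·x)ᵀ·v ≥ 0 (passive nonlinearity), 2 xᵀ P ((A+B·K)x + L·v) < 0. -/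
open Matrix

/-- If `S` is positive definite and `C * S + (C * S)ᵀ` is negative definite, then `S⁻¹` is a strict
Lyapunov certificate for `C`. -/
theorem posDef_neg_lyapunov_inv {ι : Type*} [Fintype ι] [DecidableEq ι] {S C : Matrix ι ι ℝ}
    (hS : S.PosDef) (h : (-((C * S)ᵀ + C * S)).PosDef) :
    (-(Cᵀ * S⁻¹ + S⁻¹ * C)).PosDef := by
  have hdet : IsUnit S.det := (isUnit_iff_isUnit_det S).mp hS.isUnit
  have hSt : Sᵀ = S := hS.isHermitian.eq
  have hPt : (S⁻¹)ᴴ = S⁻¹ := hS.inv.isHermitian.eq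
  have hconj := h.conjTranspose_mul_mul_same
    (mulVec_injective_of_isUnit hS.inv.isUnit)
  have hCt : S⁻¹ * (S * Cᵀ) * S⁻¹ = Cᵀ * S⁻¹ := by
    rw [nonsing_inv_mul_cancel_left S _ hdet]
  have hC : S⁻¹ * (C * S) * S⁻¹ = S⁻¹ * C := by
    rw [Matrix.mul_assoc, mul_nonsing_inv_cancel_right S _ hdet]
  rwa [hPt, Matrix.mul_neg, Matrix.neg_mul, Matrix.mul_add, Matrix.add_mul, transpose_mul, hSt,
    hCt, hC] at hconj

/-- Positive-realness: a strict Lyapunov certificate `P` for `C` with `P * L = -Hᵀ` decreases along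
`C x + L v` for every passive pair `(H x, v)`. -/
theorem lyapunov_derivative_neg_of_passive {ι κ : Type*} [Fintype ι] [Fintype κ]
    {P C : Matrix ι ι ℝ} {L : Matrix ι κ ℝ} {H : Matrix κ ι ℝ} (hP : P.IsHermitian)
    (hLyap : (-(Cᵀ * P + P * C)).PosDef) (hPL : P * L = -Hᵀ) {x : ι → ℝ} (hx : x ≠ 0)
    {v : κ → ℝ} (hv : 0 ≤ (H *ᵥ x) ⬝ᵥ v) :
    2 * (x ⬝ᵥ (P *ᵥ (C *ᵥ x + L *ᵥ v))) < 0 := by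
  have hpos := hLyap.dotProduct_mulVec_pos hx
  have hPt : Pᵀ = P := hP.eq
  have hsymm : x ⬝ᵥ ((Cᵀ * P) *ᵥ x) = x ⬝ᵥ ((P * C) *ᵥ x) := by
    rw [dotProduct_mulVec, ← mulVec_transpose, transpose_mul, transpose_transpose, hPt,
      dotProduct_comm]
  have hpassive : x ⬝ᵥ (Hᵀ *ᵥ v) = (H *ᵥ x) ⬝ᵥ v := by
    rw [dotProduct_mulVec, vecMul_transpose]
  rw [star_trivial, neg_mulVec, dotProduct_neg, add_mulVec, dotProduct_add, hsymm] at hpos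
  rw [mulVec_add, mulVec_mulVec, mulVec_mulVec, hPL, neg_mulVec, dotProduct_add, dotProduct_neg,
    hpassive]
  linarith

/-- Data-dependent strict positive realness / multivariable circle criterion: if `X0·Y ≻ 0`,
`Yᵀ Mᵀ + M Y ≺ 0` and `L + X0·Y·Hᵀ = 0`, then with `P = (X0·Y)⁻¹` and `K = U0·Y·(X0·Y)⁻¹`,
`P ≻ 0`, `(A+BK)ᵀP + P(A+BK) ≺ 0`, `P·L = −Hᵀ`, and the Lyapunov derivative is negative for
every `x ≠ 0` and any passive nonlinearity value `v` with `(Hx)ᵀ v ≥ 0`. -/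
theorem data_driven_spr_passive_nonlinearities
    (n m p T : ℕ) (hn : 0 < n) (hm : 0 < m) (hp : 0 < p) (hT : 0 < T)
    (A : Matrix (Fin n) (Fin n) ℝ) (B : Matrix (Fin n) (Fin m) ℝ)
    (L : Matrix (Fin n) (Fin p) ℝ) (H : Matrix (Fin p) (Fin n) ℝ)
    (U0 : Matrix (Fin m) (Fin T) ℝ) (X0 X1 : Matrix (Fin n) (Fin T) ℝ)
    (F0 : Matrix (Fin p) (Fin T) ℝ)
    (hdata : X1 = A * X0 + B * U0 + L * F0)
    (M : Matrix (Fin n) (Fin T) ℝ) (hMdef : M = X1 - L * F0)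
    (Y : Matrix (Fin T) (Fin n) ℝ)
    (hXY : (X0 * Y).PosDef)
    (hLyap : (-(Yᵀ * Mᵀ + M * Y)).PosDef)
    (hL : L + X0 * Y * Hᵀ = 0) :
    ((X0 * Y)⁻¹).PosDef ∧
    (-((A + B * (U0 * Y * (X0 * Y)⁻¹))ᵀ * (X0 * Y)⁻¹
        + (X0 * Y)⁻¹ * (A + B * (U0 * Y * (X0 * Y)⁻¹)))).PosDef ∧
    (X0 * Y)⁻¹ * L = -Hᵀ ∧
    (∀ (x : Fin n → ℝ), x ≠ 0 → ∀ v : Fin p → ℝ, 0 ≤ (H *ᵥ x) ⬝ᵥ v →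
      2 * (x ⬝ᵥ ((X0 * Y)⁻¹ *ᵥ
          ((A + B * (U0 * Y * (X0 * Y)⁻¹)) *ᵥ x + L *ᵥ v))) < 0) := by
  have hdet : IsUnit (X0 * Y).det := (isUnit_iff_isUnit_det _).mp hXY.isUnit
  have hMY : M * Y = (A + B * (U0 * Y * (X0 * Y)⁻¹)) * (X0 * Y) := by
    rw [Matrix.add_mul, Matrix.mul_assoc B, nonsing_inv_mul_cancel_right (X0 * Y) _ hdet, hMdef,
      hdata, add_sub_cancel_right, Matrix.add_mul, Matrix.mul_assoc, Matrix.mul_assoc]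
  have hclosed := posDef_neg_lyapunov_inv hXY (by rwa [← transpose_mul, hMY] at hLyap)
  have hPL : (X0 * Y)⁻¹ * L = -Hᵀ := by
    rw [eq_neg_of_add_eq_zero_left hL, Matrix.mul_neg, nonsing_inv_mul_cancel_left (X0 * Y) _ hdet]
  exact ⟨hXY.inv, hclosed, hPL, fun x hx v hv =>
    lyapunov_derivative_neg_of_passive hXY.inv.isHermitian hclosed hPL hx hv⟩
end

section
/- Suppose the data satisfy X1 = A·X0 + B·U0 + L·F0 and the matrix Ψ0 obtained by stacking X0, F0, U0 (in this order) has full row rank n+q+m. Then: (a) for every K ∈ ℝ^{m×n} and M ∈ ℝ^{m×q} there exist G1 ∈ ℝ^{T×n} and G2 ∈ ℝ^{T×q} with X0·G1 = I_n, F0·G1 = 0, U0·G1 = K, X0·G2 = 0, F0·G2 = I_q, U0·G2 = M; and (b) for any such G1, G2, one has A + B·K = X1·G1 and L + B·M = X1·G2. -/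
open Matrix

/-- A matrix over a field whose rank is its number of rows has a right inverse. -/
theorem Matrix.exists_mul_eq_one_of_rank_eq_card {k l R : Type*} [Fintype k] [DecidableEq k]
    [Fintype l] [Field R] {P : Matrix k l R} (hP : P.rank = Fintype.card k) :
    ∃ G : Matrix l k R, P * G = 1 := by
  rw [← Matrix.mulVec_surjective_iff_exists_right_inverse]
  have hrange : LinearMap.range P.mulVecLin = ⊤ := by
    apply Submodule.eq_top_of_finrank_eq
    rw [Module.finrank_fintype_fun_eq_card]
    exact hP
  exact LinearMap.range_eq_top.mp hrange

/-- Data-based representation with nonlinear feedback: if `X1 = A X0 + B U0 + L F0` and the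
stacked matrix `Ψ0 = [X0; F0; U0]` has full row rank `n + q + m`, then (a) every pair of gains
`(K, M)` can be realized by matrices `G1, G2`, and (b) for such `G1, G2`,
`A + B K = X1 G1` and `L + B M = X1 G2`. -/
theorem data_based_representation_nonlinear_feedback
    (n m q T : ℕ) (hn : 0 < n) (hm : 0 < m) (hq : 0 < q) (hT : 0 < T)
    (A : Matrix (Fin n) (Fin n) ℝ) (B : Matrix (Fin n) (Fin m) ℝ)
    (L : Matrix (Fin n) (Fin q) ℝ)
    (U0 : Matrix (Fin m) (Fin T) ℝ) (X0 X1 : Matrix (Fin n) (Fin T) ℝ)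
    (F0 : Matrix (Fin q) (Fin T) ℝ)
    (hdata : X1 = A * X0 + B * U0 + L * F0)
    (hrank : (Matrix.fromRows X0 (Matrix.fromRows F0 U0)).rank = n + q + m) :
    (∀ (K : Matrix (Fin m) (Fin n) ℝ) (M : Matrix (Fin m) (Fin q) ℝ),
        ∃ (G1 : Matrix (Fin T) (Fin n) ℝ) (G2 : Matrix (Fin T) (Fin q) ℝ),
          X0 * G1 = 1 ∧ F0 * G1 = 0 ∧ U0 * G1 = K ∧
          X0 * G2 = 0 ∧ F0 * G2 = 1 ∧ U0 * G2 = M) ∧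
    (∀ (K : Matrix (Fin m) (Fin n) ℝ) (M : Matrix (Fin m) (Fin q) ℝ)
        (G1 : Matrix (Fin T) (Fin n) ℝ) (G2 : Matrix (Fin T) (Fin q) ℝ),
        X0 * G1 = 1 → F0 * G1 = 0 → U0 * G1 = K →
        X0 * G2 = 0 → F0 * G2 = 1 → U0 * G2 = M →
        A + B * K = X1 * G1 ∧ L + B * M = X1 * G2) := by
  constructor
  · intro K M
    obtain ⟨G, hG⟩ := Matrix.exists_mul_eq_one_of_rank_eq_card
      (hrank.trans (by simp [add_assoc]))
    have solve {r : ℕ} (X : Matrix (Fin n) (Fin r) ℝ) (F : Matrix (Fin q) (Fin r) ℝ)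
        (U : Matrix (Fin m) (Fin r) ℝ) :
        ∃ H : Matrix (Fin T) (Fin r) ℝ, X0 * H = X ∧ F0 * H = F ∧ U0 * H = U := by
      refine ⟨G * fromRows X (fromRows F U), ?_⟩
      have h := congrArg (· * fromRows X (fromRows F U)) hG
      simpa only [Matrix.mul_assoc, Matrix.one_mul, fromRows_mul, fromRows_ext_iff] using h
    obtain ⟨G1, hX1, hF1, hU1⟩ := solve 1 0 K
    obtain ⟨G2, hX2, hF2, hU2⟩ := solve 0 1 M
    exact ⟨G1, G2, hX1, hF1, hU1, hX2, hF2, hU2⟩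
  · intro K M G1 G2 hX1 hF1 hU1 hX2 hF2 hU2
    subst hdata
    simp [Matrix.add_mul, Matrix.mul_assoc, hX1, hF1, hU1, hX2, hF2, hU2, add_comm]
end
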